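/- Let D be a reduced rectangular pipe dream of shape a×b. Then D is rigid if and only if no cross–elbow move can be applied to D, i.e. there is no cross p ∈ D and elbow q ∉ D such that (D \ {p}) ∪ {q} is a reduced rectangular pipe dream of shape a×b with the same permutation as D. -/

import Mathlib

/-- The simple transposition of the symmetric group on `Fin n` exchanging the
(0-based) positions `i` and `i+1`; it is the identity if `i+1 ≥ n`. -/
def simpleTransposition (n : ℕ) (i : ℕ) : Equiv.Perm (Fin n) :=
  if h : i + 1 < n then Equiv.swap ⟨i, Nat.lt_of_succ_lt h⟩ ⟨i + 1, h⟩ else 1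

/-- The number of inversions (= Coxeter length) of a permutation of `Fin n`. -/
def invCount {n : ℕ} (π : Equiv.Perm (Fin n)) : ℕ :=
  (Finset.univ.filter (fun p : Fin n × Fin n => p.1 < p.2 ∧ π p.2 < π p.1)).card

/-- A rectangular pipe dream of shape `a × b`: a set of crosses `D` inside the grid
`{1,…,a} × {1,…,b}` (first coordinate = row, from top to bottom; second = column,
from left to right).  Positions of the grid not in `D` are elbows. -/
def IsPipeDream (a b : ℕ) (D : Finset (ℕ × ℕ)) : Prop :=
  D ⊆ Finset.Icc 1 a ×ˢ Finset.Icc 1 b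

/-- The reading word of a rectangular pipe dream of shape `a × b`: read the rows from
bottom (`i = a`) to top (`i = 1`), each row from left (`j = 1`) to right (`j = b`);
a cross at `(i,j)` contributes the simple transposition `s_{i+j-1}` of `S_{a+b}`
(recorded here by its 0-based index `i + j - 2 = (i-1) + (j-1)`). -/
def readingWord (a b : ℕ) (D : Finset (ℕ × ℕ)) : List ℕ :=
  ((List.range a).reverse.flatMap fun r =>
    (List.range b).filterMap fun c =>
      if (r + 1, c + 1) ∈ D then some (r + c) else none)

/-- The permutation of a rectangular pipe dream: the product of its reading word. -/
def pdPerm (a b : ℕ) (D : Finset (ℕ × ℕ)) : Equiv.Perm (Fin (a + b)) :=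
  ((readingWord a b D).map (simpleTransposition (a + b))).prod

/-- A pipe dream is reduced if the Coxeter length of its permutation equals its number
of crosses. -/
def IsReducedPD (a b : ℕ) (D : Finset (ℕ × ℕ)) : Prop :=
  invCount (pdPerm a b D) = D.card

/-- A reduced rectangular pipe dream is rigid if it is the unique reduced rectangular
pipe dream of its shape with its permutation. -/
def IsRigid (a b : ℕ) (D : Finset (ℕ × ℕ)) : Prop :=
  ∀ D' : Finset (ℕ × ℕ), IsPipeDream a b D' → IsReducedPD a b D' →
    pdPerm a b D' = pdPerm a b D → D' = D

/-- A cross–elbow move on a rectangular pipe dream of shape `a × b`: remove one cross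
`p ∈ D` and add one cross at a different (elbow) position `q ∉ D`, so that the result
is again a reduced rectangular pipe dream of shape `a × b` with the same permutation. -/
def CrossElbowMove (a b : ℕ) (D D2 : Finset (ℕ × ℕ)) : Prop :=
  ∃ p q : ℕ × ℕ, p ∈ D ∧ q ∉ D ∧ D2 = insert q (D.erase p) ∧
    IsPipeDream a b D2 ∧ IsReducedPD a b D2 ∧ pdPerm a b D2 = pdPerm a b D

lemma st_mono {n i : ℕ} {u v : Fin n} (h : u < v) :
    simpleTransposition n i u < simpleTransposition n i v ∨
    (∃ h : i + 1 < n, u = ⟨i, Nat.lt_of_succ_lt h⟩ ∧ v = ⟨i + 1, h⟩) := by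
  unfold simpleTransposition
  split_ifs with hi
  · simp only [Equiv.swap_apply_def, Fin.ext_iff, Fin.lt_def] at *
    by_cases hh : u.val = i ∧ v.val = i + 1
    · right; exact ⟨hi, hh.1, hh.2⟩
    · left
      split_ifs <;> simp <;> omega
  · left; simpa using h

lemma st_sq (n i : ℕ) : simpleTransposition n i * simpleTransposition n i = 1 := by
  unfold simpleTransposition
  split_ifs <;> simp

lemma mem_inv {n : ℕ} (π : Equiv.Perm (Fin n)) (p q : Fin n) :
    (p, q) ∈ (Finset.univ.filter (fun p : Fin n × Fin n => p.1 < p.2 ∧ π p.2 < π p.1)) ↔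
      p < q ∧ π q < π p := by
  rw [Finset.mem_filter]
  simp

lemma inv_le_succ {n i : ℕ} (π : Equiv.Perm (Fin n)) :
    invCount (simpleTransposition n i * π) ≤ invCount π + 1 := by
  by_cases hi : i + 1 < n
  · unfold invCount
    refine le_trans (Finset.card_le_card (t := insert (π.symm ⟨i, Nat.lt_of_succ_lt hi⟩, π.symm ⟨i+1, hi⟩) (Finset.univ.filter (fun p : Fin n × Fin n => p.1 < p.2 ∧ π p.2 < π p.1))) ?_) (Finset.card_insert_le _ _)
    rintro ⟨p, q⟩ hpq
    rw [mem_inv] at hpq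
    rw [Finset.mem_insert, mem_inv, Prod.mk.injEq]
    simp only [Equiv.Perm.mul_apply] at hpq
    by_cases h : π q < π p
    · exact Or.inr ⟨hpq.1, h⟩
    · have h1 : π p < π q := lt_of_le_of_ne (not_lt.1 h) (fun e => hpq.1.ne (π.injective e))
      rcases st_mono (i := i) h1 with h2 | ⟨_, h2, h3⟩
      · exact absurd h2 (not_lt.2 hpq.2.le)
      · left; rw [← h2, ← h3]; simp
  · have : simpleTransposition n i = 1 := by simp [simpleTransposition, hi]
    simp [this]

lemma inv_descent {n i : ℕ} (π : Equiv.Perm (Fin n))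
    (h : invCount (simpleTransposition n i * π) < invCount π) :
    ∃ hi : i + 1 < n, π⁻¹ ⟨i + 1, hi⟩ < π⁻¹ ⟨i, Nat.lt_of_succ_lt hi⟩ := by
  by_contra hc
  push Not at hc
  apply absurd h
  rw [not_lt]
  apply Finset.card_le_card
  rintro ⟨p, q⟩ hpq
  rw [mem_inv] at hpq ⊢
  simp only [Equiv.Perm.mul_apply]
  refine ⟨hpq.1, ?_⟩
  rcases st_mono (i := i) hpq.2 with h2 | ⟨hi, h2, h3⟩
  · exact h2
  · have := hc hi
    rw [← h2, ← h3] at this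
    simp at this
    exact absurd hpq.1 (not_lt.2 this)

section
variable {α : Type*} [DecidableEq α]

/-- product of the letters of `Q` in `D` -/
def wp (n : ℕ) (f : α → ℕ) (Q : List α) (D : Finset α) : Equiv.Perm (Fin n) :=
  (Q.map fun x => if x ∈ D then simpleTransposition n (f x) else 1).prod

lemma wp_cons_mem {n : ℕ} {f : α → ℕ} {Q : List α} {D : Finset α} {x : α} (h : x ∈ D) :
    wp n f (x :: Q) D = simpleTransposition n (f x) * wp n f Q D := by
  simp [wp, h]

lemma wp_cons_not {n : ℕ} {f : α → ℕ} {Q : List α} {D : Finset α} {x : α} (h : x ∉ D) :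
    wp n f (x :: Q) D = wp n f Q D := by
  simp [wp, h]

lemma wp_congr {n : ℕ} {f : α → ℕ} {Q : List α} {D E : Finset α}
    (h : ∀ x ∈ Q, (x ∈ D ↔ x ∈ E)) : wp n f Q D = wp n f Q E := by
  unfold wp
  congr 1
  apply List.map_congr_left
  intro x hx
  simp [h x hx]

/-- number of letters used -/
def wc (Q : List α) (D : Finset α) : ℕ := Q.countP (· ∈ D)

lemma wc_cons_mem {Q : List α} {D : Finset α} {x : α} (h : x ∈ D) :
    wc (x :: Q) D = wc Q D + 1 := by
  simp [wc, h]

lemma wc_cons_not {Q : List α} {D : Finset α} {x : α} (h : x ∉ D) :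
    wc (x :: Q) D = wc Q D := by
  simp [wc, h]

lemma wc_congr {Q : List α} {D E : Finset α}
    (h : ∀ x ∈ Q, (x ∈ D ↔ x ∈ E)) : wc Q D = wc Q E := by
  unfold wc
  apply List.countP_congr
  intro x hx
  simp [h x hx]

lemma wc_erase {Q : List α} (hQ : Q.Nodup) {D : Finset α} {p : α} (hp : p ∈ Q) (hD : p ∈ D) :
    wc Q (D.erase p) + 1 = wc Q D := by
  induction Q with
  | nil => simp at hp
  | cons x Q ih =>
    rw [List.nodup_cons] at hQ
    by_cases hx : x = p
    · subst hx
      rw [wc_cons_not (by simp), wc_cons_mem hD]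
      congr 1
      apply wc_congr
      intro y hy
      have : y ≠ x := fun e => hQ.1 (e ▸ hy)
      simp [this]
    · have hp' : p ∈ Q := by simpa [Ne.symm hx] using hp
      have := ih hQ.2 hp'
      by_cases hxD : x ∈ D
      · rw [wc_cons_mem hxD, wc_cons_mem (by simp [hx, hxD])]; omega
      · rw [wc_cons_not hxD, wc_cons_not (by simp [hxD])]; omega

lemma inv_le_wc (n : ℕ) (f : α → ℕ) (Q : List α) (D : Finset α) :
    invCount (wp n f Q D) ≤ wc Q D := by
  induction Q with
  | nil =>
    simp only [wp, wc, invCount, List.map_nil, List.prod_nil, List.countP_nil, Nat.le_zero,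
      Finset.card_eq_zero]
    ext ⟨p, q⟩
    rw [mem_inv]
    simp
    exact fun h => h.le
  | cons x Q ih =>
    by_cases hxD : x ∈ D
    · rw [wc_cons_mem hxD, wp_cons_mem hxD]
      exact (inv_le_succ _).trans (by omega)
    · rw [wc_cons_not hxD, wp_cons_not hxD]; exact ih

lemma exchange {n : ℕ} {f : α → ℕ} {Q : List α} (hQ : Q.Nodup) {D : Finset α} {u v : Fin n}
    (huv : u < v) (h : (wp n f Q D)⁻¹ v < (wp n f Q D)⁻¹ u) :
    ∃ p ∈ Q, p ∈ D ∧ wp n f Q (D.erase p) = Equiv.swap u v * wp n f Q D := by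
  induction Q generalizing u v with
  | nil => simp [wp] at h; exact absurd huv (not_lt.2 h.le)
  | cons x Q ih =>
    rw [List.nodup_cons] at hQ
    by_cases hxD : x ∈ D
    · rw [wp_cons_mem hxD] at h ⊢
      have hs : (simpleTransposition n (f x))⁻¹ = simpleTransposition n (f x) :=
        inv_eq_of_mul_eq_one_left (st_sq _ _)
      rcases st_mono (i := f x) huv with h1 | ⟨hi, h2, h3⟩
      · rw [mul_inv_rev, hs, Equiv.Perm.mul_apply, Equiv.Perm.mul_apply] at h
        obtain ⟨p, hp, hpD, e⟩ := ih hQ.2 h1 h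
        have hxp : x ≠ p := fun e => hQ.1 (e ▸ hp)
        refine ⟨p, by simp [hp], hpD, ?_⟩
        rw [wp_cons_mem (by simp [hxp, hxD]), e, Equiv.swap_apply_apply, hs]
        simp only [← mul_assoc, st_sq, one_mul]
      · refine ⟨x, by simp, hxD, ?_⟩
        rw [wp_cons_not (by simp)]
        have : simpleTransposition n (f x) = Equiv.swap u v := by
          simp [simpleTransposition, hi, h2, h3]
        rw [← this, ← mul_assoc, st_sq, one_mul]
        apply wp_congr
        intro y hy
        have : y ≠ x := fun e => hQ.1 (e ▸ hy)
        simp [this]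
    · rw [wp_cons_not hxD] at h ⊢
      obtain ⟨p, hp, hpD, e⟩ := ih hQ.2 huv h
      refine ⟨p, by simp [hp], hpD, ?_⟩
      rw [wp_cons_not (by simp [hxD]), e]

lemma exchange' {n i : ℕ} {f : α → ℕ} {Q : List α} (hQ : Q.Nodup) {D : Finset α}
    (h : invCount (simpleTransposition n i * wp n f Q D) < invCount (wp n f Q D)) :
    ∃ p ∈ Q, p ∈ D ∧ wp n f Q (D.erase p) = simpleTransposition n i * wp n f Q D := by
  obtain ⟨hi, h⟩ := inv_descent _ h
  obtain ⟨p, hp, hD, e⟩ := exchange hQ (by rw [Fin.lt_def]; simp) h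
  exact ⟨p, hp, hD, by rw [e]; simp [simpleTransposition, hi]⟩

lemma main_move {n : ℕ} {f : α → ℕ} {Q : List α} (hQ : Q.Nodup) {D E : Finset α}
    (hD : invCount (wp n f Q D) = wc Q D) (hE : invCount (wp n f Q E) = wc Q E)
    (hDE : wp n f Q D = wp n f Q E) (hne : ∃ x ∈ Q, ¬ (x ∈ D ↔ x ∈ E)) :
    ∃ p ∈ Q, ∃ q ∈ Q, p ∈ D ∧ q ∉ D ∧ wp n f Q (insert q (D.erase p)) = wp n f Q D := by
  induction Q generalizing E with
  | nil => simp at hne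
  | cons x Q ih =>
    rw [List.nodup_cons] at hQ
    have hnx : ∀ y ∈ Q, y ≠ x := fun y hy e => hQ.1 (e ▸ hy)
    by_cases hxD : x ∈ D
    · -- the recursive step on `Q`
      have key : ∀ F : Finset α, invCount (wp n f Q F) = wc Q F → wp n f Q D = wp n f Q F →
          (∃ x ∈ Q, ¬ (x ∈ D ↔ x ∈ F)) → ∃ p ∈ x :: Q, ∃ q ∈ x :: Q, p ∈ D ∧ q ∉ D ∧
          wp n f (x :: Q) (insert q (D.erase p)) = wp n f (x :: Q) D := by
        intro F h1 h2 h3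
        have h0 : invCount (wp n f Q D) = wc Q D := by
          rw [wp_cons_mem hxD, wc_cons_mem hxD] at hD
          have := inv_le_succ (i := f x) (wp n f Q D)
          have := inv_le_wc n f Q D
          omega
        obtain ⟨p, hp, q, hq, hpD, hqD, e⟩ := ih hQ.2 h0 h1 h2 h3
        refine ⟨p, by simp [hp], q, by simp [hq], hpD, hqD, ?_⟩
        rw [wp_cons_mem (by simp [hxD, (hnx p hp).symm]), wp_cons_mem hxD, e]
      by_cases hxE : x ∈ E
      · have hDE' : wp n f Q D = wp n f Q E := by
          rw [wp_cons_mem hxD, wp_cons_mem hxE] at hDE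
          exact mul_left_cancel hDE
        apply key E _ hDE'
        · obtain ⟨y, hy, h⟩ := hne
          rcases List.mem_cons.1 hy with rfl | hy
          · exact absurd (by simp [hxD, hxE]) h
          · exact ⟨y, hy, h⟩
        · rw [wp_cons_mem hxE, wc_cons_mem hxE] at hE
          have := inv_le_succ (i := f x) (wp n f Q E)
          have := inv_le_wc n f Q E
          omega
      · have hd := hDE
        rw [hDE] at hD
        rw [wp_cons_mem hxD, wp_cons_not hxE] at hDE
        rw [wp_cons_not hxE] at hD hE
        rw [wc_cons_mem hxD] at hD
        rw [wc_cons_not hxE] at hE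
        have hsE : simpleTransposition n (f x) * wp n f Q E = wp n f Q D := by
          rw [← hDE, ← mul_assoc, st_sq, one_mul]
        have h1 := inv_le_succ (i := f x) (wp n f Q D)
        rw [hDE] at h1
        have h2 := inv_le_wc n f Q D
        obtain ⟨p, hp, hpE, e⟩ := exchange' (i := f x) (n := n) (f := f) hQ.2 (D := E)
          (by rw [hsE]; omega)
        rw [hsE] at e
        by_cases hag : ∀ y ∈ Q, (y ∈ D ↔ y ∈ E.erase p)
        · refine ⟨x, by simp, p, by simp [hp], hxD, ?_, ?_⟩
          · rw [hag p hp]; simp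
          · rw [hd]
            apply wp_congr
            intro y hy
            rcases List.mem_cons.1 hy with rfl | hy
            · simp [hxE, (hnx p hp).symm]
            · by_cases hyp : y = p
              · simp [hyp, hpE]
              · have := hag y hy
                simp [hyp, hnx y hy] at this ⊢
                exact this
        · push Not at hag
          apply key (E.erase p) _ e.symm
          · obtain ⟨y, hy, h⟩ := hag
            exact ⟨y, hy, by tauto⟩
          · have := wc_erase hQ.2 hp hpE
            rw [e]; omega
    · rw [wp_cons_not hxD] at hDE hD
      rw [wc_cons_not hxD] at hD
      by_cases hxE : x ∈ E
      · rw [wp_cons_mem hxE] at hDE hE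
        rw [wc_cons_mem hxE] at hE
        have hsD : simpleTransposition n (f x) * wp n f Q D = wp n f Q E := by
          rw [hDE, ← mul_assoc, st_sq, one_mul]
        have h2 := inv_le_wc n f Q E
        obtain ⟨p, hp, hpD, e⟩ := exchange' (i := f x) (n := n) (f := f) hQ.2 (D := D)
          (by rw [hsD, hDE]; omega)
        refine ⟨p, by simp [hp], x, by simp, hpD, hxD, ?_⟩
        rw [wp_cons_mem (by simp), wp_cons_not hxD,
          wp_congr (E := D.erase p) (fun y hy => by simp [hnx y hy]), e, ← mul_assoc, st_sq, one_mul]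
      · rw [wp_cons_not hxE] at hDE hE
        rw [wc_cons_not hxE] at hE
        obtain ⟨p, hp, q, hq, hpD, hqD, e⟩ := ih hQ.2 hD hE hDE (by
          obtain ⟨y, hy, h⟩ := hne
          rcases List.mem_cons.1 hy with rfl | hy
          · exact absurd (by simp [hxD, hxE]) h
          · exact ⟨y, hy, h⟩)
        refine ⟨p, by simp [hp], q, by simp [hq], hpD, hqD, ?_⟩
        rw [wp_cons_not (by simp [hxD, (hnx q hq).symm]), wp_cons_not hxD, e]
end

/-- all positions in reading order -/
def gridList (a b : ℕ) : List (ℕ × ℕ) :=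
  (List.range a).reverse.flatMap fun r => (List.range b).map fun c => (r + 1, c + 1)

lemma mem_gridList {a b : ℕ} {x : ℕ × ℕ} :
    x ∈ gridList a b ↔ x ∈ Finset.Icc 1 a ×ˢ Finset.Icc 1 b := by
  obtain ⟨i, j⟩ := x
  simp only [gridList, List.mem_flatMap, List.mem_reverse, List.mem_range, List.mem_map,
    Prod.mk.injEq, Finset.mem_product, Finset.mem_Icc]
  constructor
  · rintro ⟨r, hr, c, hc, rfl, rfl⟩; omega
  · rintro h
    exact ⟨i - 1, by omega, j - 1, by omega, by omega, by omega⟩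

lemma nodup_gridList (a b : ℕ) : (gridList a b).Nodup := by
  unfold gridList
  rw [List.nodup_flatMap]
  refine ⟨fun r _ => List.Nodup.map (fun x y h => by simpa using h) List.nodup_range, ?_⟩
  have : (List.range a).reverse.Nodup := List.nodup_reverse.2 List.nodup_range
  refine List.Pairwise.imp ?_ this
  intro r s hrs
  simp only [Function.onFun, List.disjoint_left, List.mem_map]
  rintro x ⟨c, _, rfl⟩ ⟨d, _, h⟩
  simp at h
  omega

lemma pdPerm_eq (a b : ℕ) (D : Finset (ℕ × ℕ)) :
    pdPerm a b D = wp (a + b) (fun x => (x.1 - 1) + (x.2 - 1)) (gridList a b) D := by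
  unfold pdPerm wp readingWord gridList
  generalize (List.range a).reverse = L
  induction L with
  | nil => simp
  | cons r L ih =>
    simp only [List.flatMap_cons, List.map_append, List.prod_append, ih]
    congr 1
    generalize List.range b = M
    induction M with
    | nil => simp
    | cons c M ih =>
      by_cases h : (r + 1, c + 1) ∈ D
      · simp [h] at ih ⊢
        exact ih
      · simp [h] at ih ⊢
        exact ih

lemma wc_grid {a b : ℕ} {D : Finset (ℕ × ℕ)} (h : IsPipeDream a b D) :
    wc (gridList a b) D = D.card := by
  unfold wc
  rw [List.countP_eq_length_filter, ← List.toFinset_card_of_nodup ((nodup_gridList a b).filter _)]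
  congr 1
  ext x
  simp only [List.mem_toFinset, List.mem_filter, mem_gridList, decide_eq_true_eq]
  exact ⟨fun h => h.2, fun hx => ⟨h hx, hx⟩⟩

/-- A reduced rectangular pipe dream `D` of shape `a × b` is rigid if
and only if no cross–elbow move can be applied to `D`. -/
theorem rigid_iff_no_cross_elbow_move (a b : ℕ) (D : Finset (ℕ × ℕ))
    (hpd : IsPipeDream a b D) (hred : IsReducedPD a b D) :
    IsRigid a b D ↔ ¬ ∃ D2 : Finset (ℕ × ℕ), CrossElbowMove a b D D2 := by
  constructor
  · rintro h ⟨D2, p, q, hp, hq, he, h1, h2, h3⟩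
    have := h D2 h1 h2 h3
    apply hq
    rw [← this, he]
    simp
  · intro h E hE hEr hp
    by_contra hne
    apply h
    have hD' := hred
    have hE' := hEr
    unfold IsReducedPD at hD' hE'
    rw [← wc_grid hpd, pdPerm_eq] at hD'
    rw [← wc_grid hE, pdPerm_eq] at hE'
    have hp' := hp
    rw [pdPerm_eq, pdPerm_eq] at hp'
    obtain ⟨p, hpQ, q, hqQ, hpD, hqD, e⟩ := main_move (nodup_gridList a b) hD' hE' hp'.symm (by
      by_contra hc
      push Not at hc
      apply hne
      ext x
      by_cases hx : x ∈ gridList a b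
      · exact (by have := hc x hx; tauto)
      · have h1 : x ∉ E := fun hh => hx (mem_gridList.2 (hE hh))
        have h2 : x ∉ D := fun hh => hx (mem_gridList.2 (hpd hh))
        simp [h1, h2])
    rw [← pdPerm_eq, ← pdPerm_eq] at e
    refine ⟨_, p, q, hpD, hqD, rfl, ?_, ?_, e⟩
    · intro y hy
      rcases Finset.mem_insert.1 hy with rfl | hy
      · exact mem_gridList.1 hqQ
      · exact hpd (Finset.mem_of_mem_erase hy)
    · unfold IsReducedPD
      rw [e, Finset.card_insert_of_notMem (fun hh => hqD (Finset.mem_of_mem_erase hh)),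
        Finset.card_erase_add_one hpD]
      exact hred
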